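/- Let π be a permutation of {1,...,n} and let G be its permutation graph. Suppose there exist distinct vertices v, l, r, t, b such that: l, v, r are three consecutive vertices in value order (π-values consecutive) with l leftmost and r rightmost in position, and t, v, b are three consecutive vertices in position order with t highest and b lowest in value. Then for every vertex z ∉ {v, l, r, t, b}, z is adjacent to v if and only if (z adjacent to r and z adjacent to b) or (z adjacent to l and z adjacent to t). In particular, v is a function of {l, r, t, b}. -/

import Mathlib

/-- Adjacency in the permutation graph of `π`:
`i ∼ j` iff `(i - j)(π i - π j) < 0`. -/
def PermAdj {n : ℕ} (π : Equiv.Perm (Fin n)) (i j : Fin n) : Prop :=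
  ((i.1 : ℤ) - (j.1 : ℤ)) * (((π i).1 : ℤ) - ((π j).1 : ℤ)) < 0

theorem permAdj_iff {n : ℕ} (π : Equiv.Perm (Fin n)) (i j : Fin n) :
    PermAdj π i j ↔
      (j.1 < i.1 ∧ (π i).1 < (π j).1) ∨ (i.1 < j.1 ∧ (π j).1 < (π i).1) := by
  unfold PermAdj
  rw [mul_neg_iff]
  omega

theorem lt_all_or_all_lt_of_max_eq_min_add_two {a b c z : ℕ}
    (h : max (max a b) c = min (min a b) c + 2) (hab : a ≠ b) (hac : a ≠ c) (hbc : b ≠ c)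
    (hza : z ≠ a) (hzb : z ≠ b) (hzc : z ≠ c) :
    (z < a ∧ z < b ∧ z < c) ∨ (a < z ∧ b < z ∧ c < z) := by
  obtain ⟨m, hm⟩ : ∃ m, m = min (min a b) c := ⟨_, rfl⟩
  rw [← hm] at h
  have ha : a = m ∨ a = m + 1 ∨ a = m + 2 := by omega
  have hb : b = m ∨ b = m + 1 ∨ b = m + 2 := by omega
  have hc : c = m ∨ c = m + 1 ∨ c = m + 2 := by omega
  clear h hm
  rcases ha with rfl | rfl | rfl <;> rcases hb with rfl | rfl | rfl <;>
    rcases hc with hc | hc | hc <;> omega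

/-- If `v` is simultaneously a vertical and a horizontal middle point, i.e. there
are distinct vertices `l, v, r` with consecutive `π`-values, `l` leftmost and `r`
rightmost in position, and distinct vertices `t, v, b` with consecutive positions,
`t` highest and `b` lowest in value, then for every other vertex `z`,
`z ∼ v` iff (`z ∼ r` and `z ∼ b`) or (`z ∼ l` and `z ∼ t`); in particular `v` is a
function of `{l, r, t, b}`. -/
theorem stmt12 {n : ℕ} (π : Equiv.Perm (Fin n)) (v l r t b : Fin n)
    (hdistinct : [v, l, r, t, b].Pairwise (· ≠ ·))
    -- l, v, r have consecutive π-values, with l leftmost and r rightmost: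
    (hlr : l.1 < v.1 ∧ v.1 < r.1)
    (hconsval : max (max (π l).1 (π v).1) (π r).1 = min (min (π l).1 (π v).1) (π r).1 + 2)
    -- t, v, b have consecutive positions, with b lowest and t highest value:
    (htb : (π b).1 < (π v).1 ∧ (π v).1 < (π t).1)
    (hconspos : max (max t.1 v.1) b.1 = min (min t.1 v.1) b.1 + 2) :
    ∀ z : Fin n, z ≠ v → z ≠ l → z ≠ r → z ≠ t → z ≠ b →
      (PermAdj π v z ↔ (PermAdj π r z ∧ PermAdj π b z) ∨ (PermAdj π l z ∧ PermAdj π t z)) := by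
  intro z hzv hzl hzr hzt hzb
  simp only [List.pairwise_cons, List.mem_cons, List.not_mem_nil, or_false, forall_eq_or_imp,
    forall_eq] at hdistinct
  obtain ⟨⟨hvl, hvr, hvt, hvb⟩, ⟨hlr', -, -⟩, -, htb', -⟩ := hdistinct
  have val_ne : ∀ {i j : Fin n}, i ≠ j → i.1 ≠ j.1 := fun h => Fin.val_ne_of_ne h
  have map_ne : ∀ {i j : Fin n}, i ≠ j → (π i).1 ≠ (π j).1 :=
    fun h => Fin.val_ne_of_ne (π.injective.ne h)
  have hval := lt_all_or_all_lt_of_max_eq_min_add_two hconsval (map_ne hvl.symm) (map_ne hlr')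
    (map_ne hvr) (map_ne hzl) (map_ne hzv) (map_ne hzr)
  have hpos := lt_all_or_all_lt_of_max_eq_min_add_two hconspos (val_ne hvt.symm) (val_ne htb')
    (val_ne hvb) (val_ne hzt) (val_ne hzv) (val_ne hzb)
  simp only [permAdj_iff]
  clear hconsval hconspos
  rcases hval with ⟨_, _, _⟩ | ⟨_, _, _⟩ <;> rcases hpos with ⟨_, _, _⟩ | ⟨_, _, _⟩ <;> omega
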